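/- Let d ≥ 1, λ > 0, let f : ℝ^d → ℝ be continuously differentiable, and let p : ℝ^d → (0, ∞) be a continuously differentiable probability density with sup_x p(x) + sup_x ‖∇p(x)‖ < ∞. For σ > 0 let p_σ be the Gaussian smoothing of p and s_σ^π(x) = ∫_Θ J_{g_θ}(x)ᵀ (∇ log p_σ)(g_θ(x)) dπ(θ) the equivariant smoothed score for a family of transformations (Θ, 𝒜, π, g) with g jointly measurable, each g_θ continuously differentiable, and Jacobians jointly measurable. Assume: (i) for every compact K ⊂ ℝ^d there exists C_K < ∞ with ‖g_θ(x)‖ ≤ C_K for all x ∈ K and θ ∈ Θ; (ii) sup_{x ∈ ℝ^d} ∫_Θ ‖J_{g_θ}(x)‖ dπ(θ) < ∞; (iii) the score s = ∇ log p satisfies s(x) = ∫_Θ J_{g_θ}(x)ᵀ s(g_θ(x)) dπ(θ) for every x ∈ ℝ^d (π-equivariance of p). Define S* = {x ∈ ℝ^d : ∇f(x) − λ ∇ log p(x) = 0}, for each σ > 0 define S_σ = {x ∈ ℝ^d : ∇f(x) − λ s_σ^π(x) = 0}, and let S = {x ∈ ℝ^d : there exist a sequence σ_n > 0 decreasing to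 0 and points x_n ∈ S_{σ_n} with x_n → x}. Then S ⊆ S*. -/

import Mathlib

open MeasureTheory Filter

section Mollification

variable {E F : Type*} [NormedAddCommGroup E] [InnerProductSpace ℝ E] [MeasurableSpace E]
  [BorelSpace E] [FiniteDimensional ℝ E] [NormedAddCommGroup F] [NormedSpace ℝ F]

/-- The average of `h` over the points `x - t • z`, weighted by `φ z`. -/
noncomputable def mollify (φ : E → ℝ) (h : E → F) (t : ℝ) (x : E) : F :=
  ∫ z, φ z • h (x - t • z)

theorem integrable_smul_comp_sub_smul {φ : E → ℝ} (hφ : Integrable φ) {h : E → F}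
    (hh : Continuous h) {M : ℝ} (hM : ∀ x, ‖h x‖ ≤ M) (t : ℝ) (x : E) :
    Integrable fun z => φ z • h (x - t • z) :=
  hφ.smul_bdd M (by fun_prop) (ae_of_all _ fun z => hM _)

theorem continuous_mollify {φ : E → ℝ} (hφ : Integrable φ) {h : E → F}
    (hh : Continuous h) {M : ℝ} (hM : ∀ x, ‖h x‖ ≤ M) :
    Continuous fun q : ℝ × E => mollify φ h q.1 q.2 := by
  refine continuous_of_dominated (bound := fun z => ‖φ z‖ * M)
    (fun q => (integrable_smul_comp_sub_smul hφ hh hM q.1 q.2).aestronglyMeasurable)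
    (fun q => ae_of_all _ fun z => ?_) (hφ.norm.mul_const M) (ae_of_all _ fun z => by fun_prop)
  rw [norm_smul]
  exact mul_le_mul_of_nonneg_left (hM _) (norm_nonneg _)

theorem mollify_zero {φ : E → ℝ} (hφ1 : ∫ z, φ z = 1) [CompleteSpace F] (h : E → F) (x : E) :
    mollify φ h 0 x = h x := by
  simp [mollify, integral_smul_const, hφ1]

theorem mollify_pos {φ : E → ℝ} (hφ : Integrable φ) (hφpos : ∀ z, 0 < φ z) {p : E → ℝ}
    (hp : Continuous p) (hppos : ∀ x, 0 < p x) {M : ℝ} (hM : ∀ x, ‖p x‖ ≤ M) (t : ℝ) (x : E) :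
    0 < mollify φ p t x := by
  have hpos : ∀ z, 0 < φ z • p (x - t • z) := fun z => mul_pos (hφpos z) (hppos _)
  refine (integral_pos_iff_support_of_nonneg (fun z => (hpos z).le)
    (integrable_smul_comp_sub_smul hφ hp hM t x)).2 ?_
  have : Function.support (fun z => φ z • p (x - t • z)) = Set.univ :=
    Set.eq_univ_of_forall fun z => (hpos z).ne'
  rw [this]
  exact isOpen_univ.measure_pos _ Set.univ_nonempty

theorem hasFDerivAt_mollify {φ : E → ℝ} (hφ : Integrable φ) {p : E → ℝ}
    (hp : ContDiff ℝ 1 p) {M : ℝ} (hM : ∀ x, ‖p x‖ ≤ M) (hM' : ∀ x, ‖fderiv ℝ p x‖ ≤ M)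
    (t : ℝ) (x : E) :
    HasFDerivAt (mollify φ p t) (mollify φ (fderiv ℝ p) t x) x := by
  refine hasFDerivAt_integral_of_dominated_of_fderiv_le (s := Set.univ) (𝕜 := ℝ)
    (F := fun x z => φ z • p (x - t • z)) (F' := fun x z => φ z • fderiv ℝ p (x - t • z))
    (bound := fun z => ‖φ z‖ * M) Filter.univ_mem
    (Eventually.of_forall fun y =>
      (integrable_smul_comp_sub_smul hφ hp.continuous hM t y).aestronglyMeasurable)
    (integrable_smul_comp_sub_smul hφ hp.continuous hM t x)
    (integrable_smul_comp_sub_smul hφ (hp.continuous_fderiv one_ne_zero) hM'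
      t x).aestronglyMeasurable
    (ae_of_all _ fun z y _ => ?_) (hφ.norm.mul_const M) (ae_of_all _ fun z y _ => ?_)
  · rw [norm_smul]
    exact mul_le_mul_of_nonneg_left (hM' _) (norm_nonneg _)
  · have h1 := (hp.differentiable one_ne_zero (y - t • z)).hasFDerivAt
    have h2 : HasFDerivAt (fun y : E => y - t • z) (ContinuousLinearMap.id ℝ E) y :=
      (hasFDerivAt_id y).sub_const _
    have h3 := (h1.comp y h2).const_smul (φ z)
    rwa [ContinuousLinearMap.comp_id] at h3

/-- The score of a mollified density is jointly continuous in the scale and the point,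
including at scale zero. -/
theorem continuous_gradient_log_mollify {φ : E → ℝ} (hφ : Integrable φ)
    (hφpos : ∀ z, 0 < φ z) {p : E → ℝ} (hp : ContDiff ℝ 1 p) (hppos : ∀ x, 0 < p x) {M : ℝ}
    (hM : ∀ x, ‖p x‖ ≤ M) (hM' : ∀ x, ‖fderiv ℝ p x‖ ≤ M) :
    Continuous fun q : ℝ × E => gradient (fun z => Real.log (mollify φ p q.1 z)) q.2 := by
  have hpos := mollify_pos hφ hφpos hp.continuous hppos hM
  have hfd : ∀ q : ℝ × E, gradient (fun z => Real.log (mollify φ p q.1 z)) q.2 =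
      (InnerProductSpace.toDual ℝ E).symm
        ((mollify φ p q.1 q.2)⁻¹ • mollify φ (fderiv ℝ p) q.1 q.2) := fun q => by
    rw [gradient, ((hasFDerivAt_mollify hφ hp hM hM' q.1 q.2).log (hpos q.1 q.2).ne').fderiv]
  simp_rw [hfd]
  refine (InnerProductSpace.toDual ℝ E).symm.continuous.comp (Continuous.fun_smul ?_ ?_)
  · exact (continuous_mollify hφ hp.continuous hM).inv₀ fun q => (hpos q.1 q.2).ne'
  · exact continuous_mollify hφ (hp.continuous_fderiv one_ne_zero) hM'

end Mollification

/-- The standard Gaussian density on `ℝ^d`. -/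
noncomputable def stdGaussianDensity (d : ℕ) (z : EuclideanSpace ℝ (Fin d)) : ℝ :=
  (2 * Real.pi) ^ (-(d : ℝ) / 2) * Real.exp (-‖z‖ ^ 2 / 2)

theorem stdGaussianDensity_pos (d : ℕ) (z : EuclideanSpace ℝ (Fin d)) :
    0 < stdGaussianDensity d z := by
  unfold stdGaussianDensity
  positivity

theorem integral_stdGaussianDensity (d : ℕ) : ∫ z, stdGaussianDensity d z = 1 := by
  have h := GaussianFourier.integral_rexp_neg_mul_sq_norm (V := EuclideanSpace ℝ (Fin d))
    (b := 1 / 2) (by norm_num)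
  have h2 : ∀ z : EuclideanSpace ℝ (Fin d), -‖z‖ ^ 2 / 2 = -(1 / 2) * ‖z‖ ^ 2 :=
    fun z => by ring
  simp only [stdGaussianDensity, h2]
  rw [integral_const_mul, h, finrank_euclideanSpace_fin, show Real.pi / (1 / 2) = 2 * Real.pi by
    ring, ← Real.rpow_add (by positivity)]
  simp [neg_div]

theorem integrable_stdGaussianDensity (d : ℕ) : Integrable (stdGaussianDensity d) :=
  Integrable.of_integral_ne_zero (by simp [integral_stdGaussianDensity])

theorem integral_mul_gaussian_eq_mollify (d : ℕ) (p : EuclideanSpace ℝ (Fin d) → ℝ)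
    {σ : ℝ} (hσ : 0 < σ) (x : EuclideanSpace ℝ (Fin d)) :
    ∫ y, p y * ((2 * Real.pi * σ ^ 2) ^ (-(d : ℝ) / 2) *
        Real.exp (-‖x - y‖ ^ 2 / (2 * σ ^ 2))) =
      mollify (stdGaussianDensity d) p σ x := by
  set h : EuclideanSpace ℝ (Fin d) → ℝ := fun w => p (x - w) *
    ((2 * Real.pi * σ ^ 2) ^ (-(d : ℝ) / 2) * Real.exp (-‖w‖ ^ 2 / (2 * σ ^ 2))) with hh
  have h1 := integral_sub_left_eq_self h volume x
  have h2 := Measure.integral_comp_smul volume h σ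
  rw [finrank_euclideanSpace_fin, abs_of_pos (by positivity), smul_eq_mul,
    eq_inv_mul_iff_mul_eq₀ (by positivity), ← integral_const_mul] at h2
  simp only [hh, sub_sub_cancel] at h1
  rw [h1, ← h2, mollify]
  congr 1 with z
  have h3 : (2 * Real.pi * σ ^ 2) ^ (-(d : ℝ) / 2) =
      (2 * Real.pi) ^ (-(d : ℝ) / 2) * (σ ^ d)⁻¹ := by
    rw [Real.mul_rpow (by positivity) (by positivity), ← Real.rpow_natCast σ 2,
      ← Real.rpow_mul hσ.le, ← Real.rpow_natCast σ d, ← Real.rpow_neg hσ.le]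
    congr 2
    push_cast
    ring
  have h4 : -‖σ • z‖ ^ 2 / (2 * σ ^ 2) = -‖z‖ ^ 2 / 2 := by
    rw [norm_smul, Real.norm_of_nonneg hσ.le]
    field_simp
  simp only [hh, h3, h4, stdGaussianDensity, smul_eq_mul]
  field_simp

/-- The scores of the Gaussian smoothings of `p` extend the score of `p`, at scale zero, to a
jointly continuous function of scale and point. -/
theorem exists_continuous_score_extension (d : ℕ) {p : EuclideanSpace ℝ (Fin d) → ℝ}
    (hpC : ContDiff ℝ 1 p) (hppos : ∀ x, 0 < p x) {M : ℝ} (hpbd : ∀ x, p x ≤ M)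
    (hgradbd : ∀ x, ‖gradient p x‖ ≤ M) {pσ : ℝ → EuclideanSpace ℝ (Fin d) → ℝ}
    (hpσ : ∀ σ : ℝ, 0 < σ → ∀ x, pσ σ x =
      ∫ y, p y * ((2 * Real.pi * σ ^ 2) ^ (-(d : ℝ) / 2) *
        Real.exp (-‖x - y‖ ^ 2 / (2 * σ ^ 2)))) :
    ∃ s : ℝ → EuclideanSpace ℝ (Fin d) → EuclideanSpace ℝ (Fin d),
      (Continuous fun q : ℝ × EuclideanSpace ℝ (Fin d) => s q.1 q.2) ∧
      (∀ x, gradient (fun z => Real.log (p z)) x = s 0 x) ∧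
      ∀ t, 0 < t → ∀ x, gradient (fun z => Real.log (pσ t z)) x = s t x := by
  have hpM : ∀ x, ‖p x‖ ≤ M := fun x => by
    rw [Real.norm_of_nonneg (hppos x).le]
    exact hpbd x
  have hdM : ∀ x, ‖fderiv ℝ p x‖ ≤ M := fun x => by
    simpa [gradient] using hgradbd x
  refine ⟨fun t x => gradient (fun z => Real.log (mollify (stdGaussianDensity d) p t z)) x,
    continuous_gradient_log_mollify (integrable_stdGaussianDensity d) (stdGaussianDensity_pos d)
      hpC hppos hpM hdM, fun x => ?_, fun t ht x => ?_⟩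
  · simp only [mollify_zero (integral_stdGaussianDensity d)]
  · simp only [hpσ t ht, integral_mul_gaussian_eq_mollify d p ht]

/-- Averages of `(s t ∘ g θ)` against the adjoint Jacobians of bounded transformations `g θ` are
asymptotically insensitive to `t → 0` when `s` is jointly continuous. -/
theorem tendsto_integral_adjoint_fderiv_sub {E Θ : Type*} [NormedAddCommGroup E]
    [InnerProductSpace ℝ E] [MeasurableSpace E] [BorelSpace E] [FiniteDimensional ℝ E]
    [MeasurableSpace Θ] (π : Measure Θ) {g : Θ → E → E}
    (hgm : Measurable fun q : Θ × E => g q.1 q.2)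
    (hJm : StronglyMeasurable fun q : Θ × E => fderiv ℝ (g q.1) q.2)
    (hgbd : ∀ K : Set E, IsCompact K → ∃ CK : ℝ, ∀ x ∈ K, ∀ θ, ‖g θ x‖ ≤ CK)
    (hJint : ∀ x, Integrable (fun θ => ‖fderiv ℝ (g θ) x‖) π)
    {A : ℝ} (hA : ∀ x, ∫ θ, ‖fderiv ℝ (g θ) x‖ ∂π ≤ A)
    {s : ℝ → E → E} (hscont : Continuous fun q : ℝ × E => s q.1 q.2)
    (hsint : ∀ x, Integrable (fun θ => ContinuousLinearMap.adjoint (fderiv ℝ (g θ) x)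
      (s 0 (g θ x))) π)
    {σ : ℕ → ℝ} (hσ : Tendsto σ atTop (nhds 0)) {xn : ℕ → E} {x : E}
    (hxn : Tendsto xn atTop (nhds x)) :
    Tendsto (fun n =>
      ∫ θ, ContinuousLinearMap.adjoint (fderiv ℝ (g θ) (xn n)) (s (σ n) (g θ (xn n))) ∂π -
      ∫ θ, ContinuousLinearMap.adjoint (fderiv ℝ (g θ) (xn n)) (s 0 (g θ (xn n))) ∂π)
      atTop (nhds 0) := by
  have hscont' : ∀ t, Continuous (s t) := fun t =>
    hscont.comp (by fun_prop : Continuous fun y => (t, y))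
  obtain ⟨C, hC⟩ := hgbd _ hxn.isCompact_insert_range
  have hgC' : ∀ n θ, g θ (xn n) ∈ Metric.closedBall 0 C := fun n θ => by
    simpa using hC (xn n) (Or.inr ⟨n, rfl⟩) θ
  have hA0 : 0 ≤ A := (integral_nonneg fun θ => norm_nonneg _).trans (hA 0)
  rw [Metric.tendsto_nhds]
  intro ε hε
  obtain ⟨v, hv, hvs⟩ := (isCompact_closedBall (0 : E) C)
    |>.mem_uniformity_of_prod (f := s) (s := Set.univ) (q := 0) hscont.continuousOn
      (Set.mem_univ _) (Metric.dist_mem_uniformity (show 0 < ε / (A + 1) by positivity))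
  rw [nhdsWithin_univ] at hv
  filter_upwards [hσ hv] with n hn
  have hclose : ∀ θ, ‖s (σ n) (g θ (xn n)) - s 0 (g θ (xn n))‖ ≤ ε / (A + 1) := fun θ => by
    rw [← dist_eq_norm]
    exact (hvs _ hn _ (hgC' n θ)).le
  have hbound : ∀ θ, ‖ContinuousLinearMap.adjoint (fderiv ℝ (g θ) (xn n))
      (s (σ n) (g θ (xn n)) - s 0 (g θ (xn n)))‖ ≤
        ‖fderiv ℝ (g θ) (xn n)‖ * (ε / (A + 1)) := fun θ => by
    refine (ContinuousLinearMap.le_opNorm _ _).trans ?_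
    rw [LinearIsometryEquiv.norm_map]
    exact mul_le_mul_of_nonneg_left (hclose θ) (norm_nonneg _)
  have hJ : StronglyMeasurable fun θ => fderiv ℝ (g θ) (xn n) :=
    hJm.comp_measurable (by fun_prop : Measurable fun θ => (θ, xn n))
  have hg : Measurable fun θ => g θ (xn n) :=
    hgm.comp (by fun_prop : Measurable fun θ => (θ, xn n))
  have hmeas : StronglyMeasurable fun θ =>
      ContinuousLinearMap.adjoint (fderiv ℝ (g θ) (xn n))
        (s (σ n) (g θ (xn n)) - s 0 (g θ (xn n))) := by
    have h1 : StronglyMeasurable fun θ =>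
        ContinuousLinearMap.adjoint (fderiv ℝ (g θ) (xn n)) :=
      ContinuousLinearMap.adjoint.continuous.comp_stronglyMeasurable hJ
    have h2 : StronglyMeasurable fun θ => s (σ n) (g θ (xn n)) - s 0 (g θ (xn n)) :=
      (((hscont' (σ n)).sub (hscont' 0)).measurable.comp hg).stronglyMeasurable
    exact isBoundedBilinearMap_apply.continuous.comp_stronglyMeasurable (h1.prodMk h2)
  have hint := Integrable.mono' ((hJint (xn n)).mul_const (ε / (A + 1)))
    hmeas.aestronglyMeasurable (ae_of_all _ hbound)
  have heq : ∫ θ, ContinuousLinearMap.adjoint (fderiv ℝ (g θ) (xn n)) (s (σ n) (g θ (xn n))) ∂π -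
      ∫ θ, ContinuousLinearMap.adjoint (fderiv ℝ (g θ) (xn n)) (s 0 (g θ (xn n))) ∂π =
      ∫ θ, ContinuousLinearMap.adjoint (fderiv ℝ (g θ) (xn n))
        (s (σ n) (g θ (xn n)) - s 0 (g θ (xn n))) ∂π := by
    rw [sub_eq_iff_eq_add, ← integral_add hint (hsint (xn n))]
    simp only [map_sub, sub_add_cancel]
  rw [dist_zero_right, heq]
  calc _ ≤ ∫ θ, ‖fderiv ℝ (g θ) (xn n)‖ * (ε / (A + 1)) ∂π :=
        norm_integral_le_of_norm_le ((hJint (xn n)).mul_const _) (ae_of_all _ hbound)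
    _ ≤ A * (ε / (A + 1)) := by
        rw [integral_mul_const]
        exact mul_le_mul_of_nonneg_right (hA _) (by positivity)
    _ < ε := by
        rw [mul_div_assoc', div_lt_iff₀ (by positivity)]
        nlinarith

/-- **Proposition 5 (convergence of critical points as σ → 0).**
Let `F = f + λ r` be the ideal objective, with critical points
`S* = {x : ∇f x − λ ∇ log p (x) = 0}`, and for each `σ > 0` let
`S_σ = {x : ∇f x − λ s_σ^π x = 0}` be the critical points of the equivariant smoothed
objective. Under boundedness of the transformations on compacts, a uniform first-moment
bound on the Jacobians, and π-equivariance of the prior `p`, every limit of points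
`x_n ∈ S_{σ_n}` along a sequence `σ_n > 0` decreasing to `0` belongs to `S*`. -/
theorem critical_points_convergence (d : ℕ) (hd : 1 ≤ d) (lam : ℝ) (hlam : 0 < lam)
    (f : EuclideanSpace ℝ (Fin d) → ℝ) (hf : ContDiff ℝ 1 f)
    (p : EuclideanSpace ℝ (Fin d) → ℝ)
    (hpC : ContDiff ℝ 1 p) (hppos : ∀ x, 0 < p x) (hp1 : ∫ y, p y = 1)
    (Mp : ℝ) (hpbd : ∀ x, p x ≤ Mp) (hgradbd : ∀ x, ‖gradient p x‖ ≤ Mp)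
    (Θ : Type*) [MeasurableSpace Θ] (π : Measure Θ) [IsProbabilityMeasure π]
    (g : Θ → EuclideanSpace ℝ (Fin d) → EuclideanSpace ℝ (Fin d))
    (hgm : Measurable fun q : Θ × EuclideanSpace ℝ (Fin d) => g q.1 q.2)
    (hgC : ∀ θ, ContDiff ℝ 1 (g θ))
    (hJm : StronglyMeasurable fun q : Θ × EuclideanSpace ℝ (Fin d) =>
      fderiv ℝ (g q.1) q.2)
    (pσ : ℝ → EuclideanSpace ℝ (Fin d) → ℝ)
    (hpσ : ∀ σ : ℝ, 0 < σ → ∀ x, pσ σ x =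
      ∫ y, p y * ((2 * Real.pi * σ ^ 2) ^ (-(d : ℝ) / 2) *
        Real.exp (-‖x - y‖ ^ 2 / (2 * σ ^ 2))))
    (sσπ : ℝ → EuclideanSpace ℝ (Fin d) → EuclideanSpace ℝ (Fin d))
    (hsσπ : ∀ σ x, sσπ σ x = ∫ θ, ContinuousLinearMap.adjoint (fderiv ℝ (g θ) x)
      (gradient (fun z => Real.log (pσ σ z)) (g θ x)) ∂π)
    (hgbd : ∀ K : Set (EuclideanSpace ℝ (Fin d)), IsCompact K →
      ∃ CK : ℝ, ∀ x ∈ K, ∀ θ, ‖g θ x‖ ≤ CK)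
    (hJint : ∀ x, Integrable (fun θ => ‖fderiv ℝ (g θ) x‖) π)
    (A : ℝ) (hA : ∀ x, ∫ θ, ‖fderiv ℝ (g θ) x‖ ∂π ≤ A)
    (hsint : ∀ x, Integrable (fun θ => ContinuousLinearMap.adjoint (fderiv ℝ (g θ) x)
      (gradient (fun z => Real.log (p z)) (g θ x))) π)
    (hequiv : ∀ x, gradient (fun z => Real.log (p z)) x =
      ∫ θ, ContinuousLinearMap.adjoint (fderiv ℝ (g θ) x)
        (gradient (fun z => Real.log (p z)) (g θ x)) ∂π) :
    {x : EuclideanSpace ℝ (Fin d) |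
        ∃ σn : ℕ → ℝ, (∀ n, 0 < σn n) ∧ StrictAnti σn ∧
          Tendsto σn atTop (nhds 0) ∧
          ∃ xn : ℕ → EuclideanSpace ℝ (Fin d),
            (∀ n, gradient f (xn n) - lam • sσπ (σn n) (xn n) = 0) ∧
            Tendsto xn atTop (nhds x)} ⊆
      {x : EuclideanSpace ℝ (Fin d) |
        gradient f x - lam • gradient (fun z => Real.log (p z)) x = 0} := by
  rintro x ⟨σ, hσpos, -, hσ, xn, hcrit, hxn⟩
  obtain ⟨s, hscont, hs0, hsσ⟩ := exists_continuous_score_extension d hpC hppos hpbd hgradbd hpσ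
  have hscont' : ∀ t, Continuous (s t) := fun t =>
    hscont.comp (by fun_prop : Continuous fun y => (t, y))
  simp only [hs0] at hsint hequiv
  have hdist : Tendsto (fun n => sσπ (σ n) (xn n) - s 0 (xn n)) atTop (nhds 0) := by
    refine (tendsto_integral_adjoint_fderiv_sub π hgm hJm hgbd hJint hA hscont hsint hσ
      hxn).congr fun n => ?_
    rw [hequiv, hsσπ]
    simp only [hsσ _ (hσpos n)]
  have hfgrad : Continuous (gradient f) :=
    (InnerProductSpace.toDual ℝ _).symm.continuous.comp (hf.continuous_fderiv one_ne_zero)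
  have hlim : Tendsto (fun n => gradient f (xn n) - lam • s 0 (xn n)) atTop
      (nhds (gradient f x - lam • s 0 x)) :=
    ((hfgrad.sub ((hscont' 0).const_smul lam)).tendsto x).comp hxn
  have hlim0 : Tendsto (fun n => gradient f (xn n) - lam • s 0 (xn n)) atTop (nhds 0) := by
    have h := hdist.const_smul lam
    rw [smul_zero] at h
    refine h.congr fun n => ?_
    rw [smul_sub, sub_eq_zero.1 (hcrit n)]
  rw [Set.mem_ofPred_eq, hs0]
  exact tendsto_nhds_unique hlim hlim0
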